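/- arXiv:1604.06878 — 2 statements merged into one kernel-verified Lean document; each statement's English description precedes it below -/
import Mathlib

section
/- Let C be an even binary [46,23] code with minimum weight at least 10 whose weight distribution equals the weight distribution of its dual code C^⊥ (i.e., C is formally self-dual). Then A_12(C) = 16744 − 7·A_10(C), A_14(C) = 38709 + 18·A_10(C), and A_16(C) = 249458 − 14·A_10(C). -/
/-- The (Hamming) weight of a vector over `ZMod 2`. -/
def wt {ι : Type*} [Fintype ι] (x : ι → ZMod 2) : ℕ :=
  (Finset.univ.filter fun i => x i ≠ 0).card

/-- The dual code of a binary linear code. -/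
def dualCode {ι : Type*} [Fintype ι] (C : Submodule (ZMod 2) (ι → ZMod 2)) :
    Submodule (ZMod 2) (ι → ZMod 2) where
  carrier := {x | ∀ c ∈ C, ∑ i, x i * c i = 0}
  zero_mem' := by intro c _; simp
  add_mem' := by
    intro a b ha hb c hc
    simp only [Set.mem_setOf_eq] at ha hb ⊢
    simp [Pi.add_apply, add_mul, Finset.sum_add_distrib, ha c hc, hb c hc]
  smul_mem' := by
    intro r a ha c hc
    simp only [Set.mem_setOf_eq] at ha ⊢
    simp [Pi.smul_apply, smul_eq_mul, mul_assoc, ← Finset.mul_sum, ha c hc]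

/-- A binary linear code is self-dual if it equals its dual. -/
def IsSelfDual {ι : Type*} [Fintype ι] (C : Submodule (ZMod 2) (ι → ZMod 2)) : Prop :=
  C = dualCode C

/-- A binary code is even if every codeword has even weight. -/
def IsEvenCode {ι : Type*} [Fintype ι] (C : Submodule (ZMod 2) (ι → ZMod 2)) : Prop :=
  ∀ c ∈ C, 2 ∣ wt c

/-- `C` has minimum weight `d`: some nonzero codeword has weight `d` and
no nonzero codeword has smaller weight. -/
def HasMinWt {ι : Type*} [Fintype ι] (C : Submodule (ZMod 2) (ι → ZMod 2)) (d : ℕ) : Prop :=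
  (∃ c ∈ C, c ≠ 0 ∧ wt c = d) ∧ ∀ c ∈ C, c ≠ 0 → d ≤ wt c

/-- `Awt C i` is the number `A_i(C)` of codewords of `C` of weight `i`. -/
noncomputable def Awt {ι : Type*} [Fintype ι]
    (C : Submodule (ZMod 2) (ι → ZMod 2)) (i : ℕ) : ℕ :=
  Set.ncard {c ∈ (C : Set (ι → ZMod 2)) | wt c = i}

/-- `C` performs better than `C'`: the weight distribution of `C` is
lexicographically smaller than that of `C'`. -/
def LexSmaller {ι : Type*} [Fintype ι]
    (C C' : Submodule (ZMod 2) (ι → ZMod 2)) : Prop :=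
  ∃ s : ℕ, (∀ i < s, Awt C i = Awt C' i) ∧ Awt C s < Awt C' s

/-- A circulant matrix: each row is the cyclic shift (by one position) of the previous one,
equivalently the matrix is invariant under simultaneously cyclically shifting rows and
columns. -/
def IsCirculant {n : ℕ} (R : Matrix (Fin n) (Fin n) (ZMod 2)) : Prop :=
  ∀ i j k : Fin n, R (i + k) (j + k) = R i j

/-- The generator matrix `(I_n | R)`. -/
def genMat {n : ℕ} (R : Matrix (Fin n) (Fin n) (ZMod 2)) :
    Matrix (Fin n) (Fin n ⊕ Fin n) (ZMod 2) :=
  Matrix.of fun i => Sum.elim (fun j => if i = j then (1 : ZMod 2) else 0) (R i)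

/-- The row space (span of the rows) of a matrix over `ZMod 2`. -/
def rowSpan {ι κ : Type*} (M : Matrix ι κ (ZMod 2)) : Submodule (ZMod 2) (κ → ZMod 2) :=
  Submodule.span (ZMod 2) (Set.range M)

/-- The bordered matrix `B` with `B 0 0 = α`, the rest of the first row and first
column all ones, and remaining block the matrix `R'`. -/
def borderMat {m : ℕ} (α : ZMod 2) (R' : Matrix (Fin m) (Fin m) (ZMod 2)) :
    Matrix (Fin (m + 1)) (Fin (m + 1)) (ZMod 2) :=
  Matrix.of fun i j =>
    if hi : i = 0 then (if j = 0 then α else 1)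
    else if hj : j = 0 then 1
    else R' (i.pred hi) (j.pred hj)

/-- `C` is a pure double circulant code of length `2n`. -/
def IsPureDC {n : ℕ} (C : Submodule (ZMod 2) (Fin n ⊕ Fin n → ZMod 2)) : Prop :=
  ∃ R : Matrix (Fin n) (Fin n) (ZMod 2), IsCirculant R ∧ C = rowSpan (genMat R)

/-- `C` is a bordered double circulant code of length `2(m+1)`. -/
def IsBorderedDC {m : ℕ} (C : Submodule (ZMod 2) (Fin (m + 1) ⊕ Fin (m + 1) → ZMod 2)) : Prop :=
  ∃ (α : ZMod 2) (R' : Matrix (Fin m) (Fin m) (ZMod 2)),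
    IsCirculant R' ∧ C = rowSpan (genMat (borderMat α R'))

/-- `C` is a double circulant code: pure or bordered. -/
def IsDC {m : ℕ} (C : Submodule (ZMod 2) (Fin (m + 1) ⊕ Fin (m + 1) → ZMod 2)) : Prop :=
  IsPureDC C ∨ IsBorderedDC C

/-- The dual of a set of vectors. -/
def dualSet {ι : Type*} [Fintype ι] (X : Set (ι → ZMod 2)) : Set (ι → ZMod 2) :=
  {x | ∀ c ∈ X, ∑ i, x i * c i = 0}

/-- The shadow `S = C_0^⊥ \ C` of `C`, where `C_0` is the doubly even subcode. -/
def shadowSet {ι : Type*} [Fintype ι] (C : Submodule (ZMod 2) (ι → ZMod 2)) :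
    Set (ι → ZMod 2) :=
  dualSet {c ∈ (C : Set (ι → ZMod 2)) | 4 ∣ wt c} \ (C : Set (ι → ZMod 2))

/-- The nontrivial character of `ZMod 2`, with integer values. -/
def signChar (a : ZMod 2) : ℤ := if a = 0 then 1 else -1

theorem signChar_add (a b : ZMod 2) : signChar (a + b) = signChar a * signChar b := by
  revert a b; decide

theorem signChar_sum {ι : Type*} (s : Finset ι) (f : ι → ZMod 2) :
    signChar (∑ i ∈ s, f i) = ∏ i ∈ s, signChar (f i) := by
  classical
  induction s using Finset.induction_on with
  | empty => simp [signChar]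
  | insert a s ha ih => rw [Finset.sum_insert ha, Finset.prod_insert ha, signChar_add, ih]

section Weight

variable {ι : Type*} [Fintype ι]

theorem prod_eq_pow_wt {R : Type*} [CommMonoid R] (x : ι → ZMod 2) (a b : R) :
    ∏ i, (if x i = 0 then a else b) = a ^ (Fintype.card ι - wt x) * b ^ wt x := by
  have h := Finset.card_filter_add_card_filter_not (s := Finset.univ) (fun i => x i = 0)
  rw [Finset.prod_ite, Finset.prod_const, Finset.prod_const, wt]
  congr 2
  simp only [Finset.card_univ, ne_eq] at h ⊢
  omega

theorem wt_le_card (x : ι → ZMod 2) : wt x ≤ Fintype.card ι :=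
  Finset.card_le_univ _

theorem wt_eq_zero_iff {x : ι → ZMod 2} : wt x = 0 ↔ x = 0 := by
  simp [wt, Finset.filter_eq_empty_iff, funext_iff]

theorem wt_eq_card_iff {x : ι → ZMod 2} : wt x = Fintype.card ι ↔ x = 1 := by
  have h : ∀ a : ZMod 2, a ≠ 0 ↔ a = 1 := by decide
  rw [wt, Finset.card_eq_iff_eq_univ, Finset.filter_eq_self]
  simp [funext_iff, h]

theorem wt_add_one (x : ι → ZMod 2) : wt (x + 1) = Fintype.card ι - wt x := by
  have h := Finset.card_filter_add_card_filter_not (s := Finset.univ) (fun i => x i ≠ 0)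
  have hx : ∀ a : ZMod 2, a + 1 ≠ 0 ↔ ¬ a ≠ 0 := by decide
  simp only [wt, Pi.add_apply, Pi.one_apply, hx]
  rw [← Finset.card_univ]
  omega

theorem sum_eq_wt (x : ι → ZMod 2) : ∑ i, x i = (wt x : ZMod 2) := by
  have h : ∀ a : ZMod 2, a = if a ≠ 0 then 1 else 0 := by decide
  rw [wt, Finset.card_filter, Nat.cast_sum]
  refine Finset.sum_congr rfl fun i _ => ?_
  simpa using h (x i)

open Classical in
theorem sum_signChar_mul_pow_wt (c : ι → ZMod 2) (z : ℤ) :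
    ∑ x : ι → ZMod 2, signChar (∑ i, x i * c i) * z ^ wt x =
      (1 + z) ^ (Fintype.card ι - wt c) * (1 - z) ^ wt c := by
  have hz : ∀ a : ZMod 2, ∑ b : ZMod 2, signChar (b * a) * (if b = 0 then 1 else z) =
      if a = 0 then 1 + z else 1 - z := by
    intro a
    rw [show (Finset.univ : Finset (ZMod 2)) = {0, 1} from rfl]
    obtain rfl | rfl : a = 0 ∨ a = 1 := by revert a; decide
    all_goals simp [signChar, sub_eq_add_neg]
  rw [← prod_eq_pow_wt, ← Finset.prod_congr rfl fun i _ => hz (c i), Finset.prod_univ_sum,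
    Fintype.piFinset_univ]
  refine Finset.sum_congr rfl fun x _ => ?_
  rw [Finset.prod_mul_distrib, ← signChar_sum, prod_eq_pow_wt, one_pow, one_mul]

variable (C : Submodule (ZMod 2) (ι → ZMod 2))

theorem mem_dualCode {x : ι → ZMod 2} : x ∈ dualCode C ↔ ∀ c ∈ C, ∑ i, x i * c i = 0 :=
  Iff.rfl

open Classical in
theorem sum_signChar_code (x : ι → ZMod 2) :
    ∑ c : C, signChar (∑ i, x i * c.1 i) = if x ∈ dualCode C then (Nat.card C : ℤ) else 0 := by
  split_ifs with hx
  · simp [fun c : C => hx c.1 c.2, signChar]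
  · rw [mem_dualCode] at hx
    push Not at hx
    obtain ⟨d, hd, hxd⟩ := hx
    have h := Equiv.sum_comp (Equiv.addRight (⟨d, hd⟩ : C))
      fun c : C => signChar (∑ i, x i * c.1 i)
    simp only [Equiv.coe_addRight, Submodule.coe_add, Pi.add_apply, mul_add,
      Finset.sum_add_distrib, signChar_add, ← Finset.sum_mul] at h
    rw [show signChar (∑ i, x i * d i) = -1 from if_neg hxd] at h
    linarith

open Classical in
/-- The MacWilliams identity for binary linear codes. -/
theorem macWilliams (z : ℤ) :
    ∑ c : C, (1 + z) ^ (Fintype.card ι - wt c.1) * (1 - z) ^ wt c.1 =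
      Nat.card C * ∑ x : dualCode C, z ^ wt x.1 := by
  simp_rw [← sum_signChar_mul_pow_wt]
  rw [Finset.sum_comm]
  simp_rw [← Finset.sum_mul, sum_signChar_code, ite_mul, zero_mul]
  rw [← Finset.sum_filter, ← Finset.mul_sum]
  congr 1
  exact Finset.sum_subtype _ (fun x => Finset.mem_filter_univ x) _

open Classical in
theorem sum_wt_eq_sum_Awt (f : ℕ → ℤ) :
    ∑ c : C, f (wt c.1) = ∑ i ∈ Finset.range (Fintype.card ι + 1), (Awt C i : ℤ) * f i := by
  rw [← Finset.sum_fiberwise_of_maps_to (g := fun c : C => wt c.1)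
    (t := Finset.range (Fintype.card ι + 1))
    fun c _ => Finset.mem_range_succ_iff.2 (wt_le_card c.1)]
  refine Finset.sum_congr rfl fun i _ => ?_
  have hA : Awt C i = (Finset.univ.filter fun c : C => wt c.1 = i).card := by
    rw [Awt, ← Finset.card_map (Function.Embedding.subtype _), ← Set.ncard_coe_finset]
    congr 1
    ext x
    simp [and_comm]
  rw [hA, ← nsmul_eq_mul, ← Finset.sum_const]
  exact Finset.sum_congr rfl fun c hc => by rw [(Finset.mem_filter.1 hc).2]

/-- The MacWilliams identity in terms of weight distributions. -/
theorem macWilliams_Awt (z : ℤ) :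
    ∑ i ∈ Finset.range (Fintype.card ι + 1),
      (Awt C i : ℤ) * ((1 + z) ^ (Fintype.card ι - i) * (1 - z) ^ i) =
      Nat.card C * ∑ i ∈ Finset.range (Fintype.card ι + 1), (Awt (dualCode C) i : ℤ) * z ^ i := by
  classical
  rw [← sum_wt_eq_sum_Awt C fun i => (1 + z) ^ (Fintype.card ι - i) * (1 - z) ^ i,
    ← sum_wt_eq_sum_Awt (dualCode C) fun i => z ^ i]
  exact macWilliams C z

variable {C}

theorem Awt_eq_zero {i : ℕ} (h : ∀ c ∈ C, wt c ≠ i) : Awt C i = 0 := by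
  rw [Awt, Set.ncard_eq_zero]
  exact Set.eq_empty_of_forall_notMem fun c hc => h c hc.1 hc.2

theorem Awt_zero : Awt C 0 = 1 := by
  rw [Awt, Set.ncard_eq_one]
  exact ⟨0, by ext x; simpa [wt_eq_zero_iff] using fun h : x = 0 => h ▸ C.zero_mem⟩

theorem Awt_card_ne_zero_iff : Awt C (Fintype.card ι) ≠ 0 ↔ (1 : ι → ZMod 2) ∈ C := by
  rw [Awt, ne_eq, Set.ncard_eq_zero, ← ne_eq, ← Set.nonempty_iff_ne_empty]
  simp only [wt_eq_card_iff]
  exact ⟨fun ⟨c, hc, h⟩ => h ▸ hc, fun h => ⟨1, h, rfl⟩⟩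

theorem Awt_card_sub (h : (1 : ι → ZMod 2) ∈ C) {i : ℕ} (hi : i ≤ Fintype.card ι) :
    Awt C (Fintype.card ι - i) = Awt C i := by
  have hinv : ∀ x : ι → ZMod 2, x + 1 + 1 = x := by
    intro x
    funext i
    simp [add_assoc, CharTwo.add_self_eq_zero]
  symm
  refine Set.ncard_congr (fun x _ => x + 1) ?_ (fun _ _ _ _ => add_right_cancel) ?_
  · rintro x ⟨hx, rfl⟩
    exact ⟨C.add_mem hx h, wt_add_one x⟩
  · rintro x ⟨hx, hw⟩
    refine ⟨x + 1, ⟨C.add_mem hx h, ?_⟩, hinv x⟩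
    rw [wt_add_one, hw]
    omega

theorem one_mem_dualCode (he : IsEvenCode C) : (1 : ι → ZMod 2) ∈ dualCode C := by
  intro c hc
  simpa [sum_eq_wt, ZMod.natCast_eq_zero_iff] using he c hc

end Weight

/-- The weight enumerator constraints for a formally self-dual even
`[46, 23]` code with minimum weight at least 10. -/
theorem stmt_14 (C : Submodule (ZMod 2) (Fin 46 → ZMod 2))
    (hdim : Module.finrank (ZMod 2) C = 23) (he : IsEvenCode C)
    (hmin : ∀ c ∈ C, c ≠ 0 → 10 ≤ wt c)
    (hfsd : ∀ i, Awt C i = Awt (dualCode C) i) :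
    (Awt C 12 : ℤ) = 16744 - 7 * (Awt C 10 : ℤ) ∧
    (Awt C 14 : ℤ) = 38709 + 18 * (Awt C 10 : ℤ) ∧
    (Awt C 16 : ℤ) = 249458 - 14 * (Awt C 10 : ℤ) := by
  have hone : (1 : Fin 46 → ZMod 2) ∈ C := by
    rw [← Awt_card_ne_zero_iff, hfsd, Awt_card_ne_zero_iff]
    exact one_mem_dualCode he
  have hcard : Nat.card C = 2 ^ 23 := by
    rw [Module.natCard_eq_pow_finrank (K := ZMod 2), hdim, Nat.card_zmod]
  have hodd (i : ℕ) (hi : ¬ 2 ∣ i) : Awt C i = 0 :=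
    Awt_eq_zero fun c hc h => hi (h ▸ he c hc)
  have hlow (i : ℕ) (hi₀ : 0 < i) (hi : i < 10) : Awt C i = 0 :=
    Awt_eq_zero fun c hc h => by
      have hc₀ : c ≠ 0 := fun h₀ => by rw [wt_eq_zero_iff.2 h₀] at h; omega
      have := hmin c hc hc₀
      omega
  have hsymm (i : ℕ) (hi : 23 < i) (hi' : i ≤ 46) : Awt C i = Awt C (46 - i) := by
    simpa using (Awt_card_sub hone (i := i) (by simpa using hi')).symm
  have hsum (f : ℕ → ℤ) : ∑ i ∈ Finset.range 47, (Awt C i : ℤ) * f i =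
      f 0 + f 46 + Awt C 10 * (f 10 + f 36) + Awt C 12 * (f 12 + f 34) +
      Awt C 14 * (f 14 + f 32) + Awt C 16 * (f 16 + f 30) + Awt C 18 * (f 18 + f 28) +
      Awt C 20 * (f 20 + f 26) + Awt C 22 * (f 22 + f 24) := by
    simp [Finset.sum_range_succ, hodd, hlow, hsymm, Awt_zero]
    ring
  have hmac (z : ℤ) := macWilliams_Awt C z
  simp only [← hfsd, hcard, Fintype.card_fin, Nat.reduceAdd, hsum] at hmac
  have h₀ := hmac 0
  have h₂ := hmac 2
  have h₄ := hmac 4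
  have h₅ := hmac 5
  have h₆ := hmac 6
  have h₇ := hmac 7
  norm_num at h₀ h₂ h₄ h₅ h₆ h₇
  refine ⟨?_, ?_, ?_⟩ <;> linarith
end

section
/- Let R be the 27×27 circulant matrix over F_2 whose first row is (1,1,1,0,0,0,0,0,0,0,1,1,1,0,1,1,0,1,1,0,0,0,1,0,0,1,1), and let C be the row space of the 27×54 matrix (I_27 | R). Then C is an even [54,27] code with minimum weight 10 which is not self-dual, and it has exactly 27 codewords of weight 10, 6030 codewords of weight 12, and 49545 codewords of weight 14. -/
/-- Evaluate `f` at `n`, reducing `n` to a literal first. -/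
def force {α : Type} (n : ℕ) (f : ℕ → α) : α :=
  match n with
  | 0 => f 0
  | Nat.succ m => f (Nat.succ m)

/-- A list of `len` numbers packed into the base `2 ^ 32` digits of `val`; `ones` packs as many
ones. -/
structure Pack where
  len : ℕ
  ones : ℕ
  val : ℕ

/-- Concatenation of the packed lists. -/
def Pack.append (p q : Pack) : Pack :=
  ⟨p.len + q.len, p.ones + q.ones <<< (32 * p.len), p.val + q.val <<< (32 * p.len)⟩

/-- Bitwise exclusive or of every packed number with `r`. -/
def Pack.xor (p : Pack) (r : ℕ) : Pack :=
  ⟨p.len, p.ones, p.val ^^^ (r * p.ones)⟩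

/-- Evaluate `f` at `p`, reducing the fields of `p` to literals first. -/
def Pack.force {α : Type} (p : Pack) (f : Pack → α) : α :=
  _root_.force p.len fun n => _root_.force p.ones fun o => _root_.force p.val fun v => f ⟨n, o, v⟩

/-- The packed numbers of ones among the lowest `b` bits of the numbers packed in `v`. -/
def bitSum (o v : ℕ) : ℕ → ℕ
  | 0 => 0
  | b + 1 => bitSum o v b + ((v >>> b) &&& o)

/-- The number of packed numbers with exactly `c` ones in binary. -/
def Pack.count (p : Pack) (c : ℕ) : ℕ :=
  ((((bitSum p.ones p.val 27 ^^^ ((31 - c) * p.ones)) + p.ones) >>> 5) &&& p.ones) % (2 ^ 32 - 1)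

/-- Given the packs `prev, p₁, p₂, …` of the sums of `j, j + 1, j + 2, …` of the previous rows,
apply `k` to the packs of sums that also take the row `r` into account, and to `acc` increased by the
number of new sums of `j + 1, j + 2, …` rows with `c, c - 1, …` ones. -/
def advance {α : Type} (r : ℕ) :
    ℕ → Pack → List Pack → ℕ → (List Pack → ℕ → α) → α
  | c, prev, [], acc, k =>
    (prev.xor r).force fun q => force (acc + q.count c) fun count₁ => k [] count₁
  | c, prev, p :: ps, acc, k =>
    (prev.xor r).force fun q => force (acc + q.count c) fun count₁ =>
      (p.append q).force fun next =>
        advance r (c - 1) p ps count₁ fun rest count₂ => k (next :: rest) count₂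

/-- Iterate `advance` over a list of rows, returning the accumulated count. -/
def run (c : ℕ) : List ℕ → List Pack → ℕ → ℕ
  | [], _, acc => acc
  | r :: rs, ps, acc => advance r c ⟨1, 1, 0⟩ ps acc fun rest count₁ => run c rs rest count₁

/-- The number `a` with its 27 binary digits cyclically shifted by `i` places. -/
def circRow (a : ℕ) (i : Fin 27) : ℕ := a * 2 ^ (i : ℕ) % (2 ^ 27 - 1)

/-- The number of nonempty sets of `i ≤ K + 1` cyclic shifts of `a` whose exclusive or has
`c + 1 - i` ones, for `c ≤ 27`. -/
def total (a K c : ℕ) : ℕ :=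
  run c ((List.finRange 27).map (circRow a)).reverse (List.replicate K ⟨0, 0, 0⟩) 0

/-- The number of ones among the lowest 27 binary digits. -/
def popCount (a : ℕ) : ℕ := ∑ b ∈ Finset.range 27, (a.testBit b).toNat

lemma force_eq {α : Type} (n : ℕ) (f : ℕ → α) : force n f = f n := by
  cases n <;> rfl

lemma Pack.force_eq {α : Type} (p : Pack) (f : Pack → α) : p.force f = f p := by
  simp [Pack.force, _root_.force_eq]

lemma xor_digit {a b : ℕ} (x y : ℕ) (ha : a < 2 ^ 32) (hb : b < 2 ^ 32) :
    (a + 2 ^ 32 * x) ^^^ (b + 2 ^ 32 * y) = (a ^^^ b) + 2 ^ 32 * (x ^^^ y) := by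
  have hab := Nat.xor_lt_two_pow ha hb
  rw [add_comm a, add_comm b, add_comm (a ^^^ b)]
  apply Nat.eq_of_testBit_eq
  intro j
  simp only [Nat.testBit_xor, Nat.testBit_two_pow_mul_add _ ha, Nat.testBit_two_pow_mul_add _ hb,
    Nat.testBit_two_pow_mul_add _ hab]
  split_ifs <;> rfl

lemma shift_and_digit {a b : ℕ} (x y : ℕ) (ha : a < 2 ^ 32) (hb : b < 32) :
    ((a + 2 ^ 32 * x) >>> b) &&& (1 + 2 ^ 32 * y) =
      (a.testBit b).toNat + 2 ^ 32 * ((x >>> b) &&& y) := by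
  have h1 : (1 : ℕ) < 2 ^ 32 := by norm_num
  have hab : (a.testBit b).toNat < 2 ^ 32 := lt_of_le_of_lt (Bool.toNat_le _) h1
  rw [add_comm a, add_comm 1, add_comm (a.testBit b).toNat]
  apply Nat.eq_of_testBit_eq
  intro j
  simp only [Nat.testBit_and, Nat.testBit_shiftRight, Nat.testBit_two_pow_mul_add _ ha,
    Nat.testBit_two_pow_mul_add _ h1, Nat.testBit_two_pow_mul_add _ hab]
  by_cases hj : j < 32
  · rcases Nat.eq_zero_or_pos j with rfl | hj0
    · cases h : a.testBit b <;> simp [hb]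
    · have e1 : Nat.testBit 1 j = false := by
        rw [← pow_zero 2, Nat.testBit_two_pow_of_ne (by omega)]
      have e2 : (a.testBit b).toNat.testBit j = false := by
        cases a.testBit b
        · simp
        · simpa using e1
      simp [hj, e1, e2]
  · have h2 : ¬ b + j < 32 := by omega
    simp only [hj, h2, if_false]
    congr 2
    omega

lemma ofDigits_map_xor {r : ℕ} (hr : r < 2 ^ 32) (l : List ℕ) (hl : ∀ a ∈ l, a < 2 ^ 32) :
    Nat.ofDigits (2 ^ 32) l ^^^ (r * Nat.ofDigits (2 ^ 32) (l.map fun _ => 1)) =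
      Nat.ofDigits (2 ^ 32) (l.map (· ^^^ r)) := by
  induction l with
  | nil => simp
  | cons a l ih =>
    simp only [List.mem_cons, forall_eq_or_imp] at hl
    simp only [List.map_cons, Nat.ofDigits_cons, ← ih hl.2]
    rw [← xor_digit _ _ hl.1 hr]
    ring_nf

lemma ofDigits_map_testBit {b : ℕ} (hb : b < 32) (l : List ℕ) (hl : ∀ a ∈ l, a < 2 ^ 32) :
    (Nat.ofDigits (2 ^ 32) l >>> b) &&& Nat.ofDigits (2 ^ 32) (l.map fun _ => 1) =
      Nat.ofDigits (2 ^ 32) (l.map fun a => (a.testBit b).toNat) := by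
  induction l with
  | nil => simp
  | cons a l ih =>
    simp only [List.mem_cons, forall_eq_or_imp] at hl
    simp only [List.map_cons, Nat.ofDigits_cons, ← ih hl.2]
    exact shift_and_digit _ _ hl.1 hb

lemma ofDigits_map_add (B : ℕ) (f g : ℕ → ℕ) (l : List ℕ) :
    Nat.ofDigits B (l.map f) + Nat.ofDigits B (l.map g) =
      Nat.ofDigits B (l.map fun a => f a + g a) := by
  induction l with
  | nil => simp
  | cons a l ih =>
    simp only [List.map_cons, Nat.ofDigits_cons, ← ih]
    ring

lemma bitSum_eq (l : List ℕ) (hl : ∀ a ∈ l, a < 2 ^ 32) {n : ℕ} (hn : n ≤ 32) :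
    bitSum (Nat.ofDigits (2 ^ 32) (l.map fun _ => 1)) (Nat.ofDigits (2 ^ 32) l) n =
      Nat.ofDigits (2 ^ 32) (l.map fun a => ∑ b ∈ Finset.range n, (a.testBit b).toNat) := by
  induction n with
  | zero =>
    simp only [bitSum, Finset.range_zero, Finset.sum_empty]
    clear hl
    induction l with
    | nil => simp
    | cons a l ih => simp [Nat.ofDigits_cons]
  | succ n ih =>
    rw [bitSum, ih (by omega), ofDigits_map_testBit (by omega) l hl, ofDigits_map_add]
    simp only [Finset.sum_range_succ]

lemma ofDigits_mod_eq_sum (l : List ℕ) (hl : l.sum < 2 ^ 32 - 1) :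
    Nat.ofDigits (2 ^ 32) l % (2 ^ 32 - 1) = l.sum := by
  have h := Nat.ofDigits_modEq' (2 ^ 32) 1 (2 ^ 32 - 1) (by decide) l
  rw [Nat.ofDigits_one] at h
  exact Eq.trans h (Nat.mod_eq_of_lt hl)

lemma popCount_le (a : ℕ) : popCount a ≤ 27 := by
  refine (Finset.sum_le_card_nsmul _ _ 1 fun b _ => Bool.toNat_le _).trans ?_
  simp

/-- `p` packs the list `l`. -/
structure Pack.Represents (p : Pack) (l : List ℕ) : Prop where
  len : p.len = l.length
  ones : p.ones = Nat.ofDigits (2 ^ 32) (l.map fun _ => 1)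
  val : p.val = Nat.ofDigits (2 ^ 32) l
  lt : ∀ a ∈ l, a < 2 ^ 32

lemma eq_test : ∀ a ≤ 27, ∀ c ≤ 27,
    (((a ^^^ (31 - c)) + 1).testBit 5).toNat = if a = c then 1 else 0 := by
  decide

lemma Pack.Represents.count_eq {p : Pack} {l : List ℕ} (h : p.Represents l)
    (hlen : l.length < 2 ^ 32 - 1) {c : ℕ} (hc : c ≤ 27) :
    p.count c = l.countP fun a => popCount a = c := by
  have hsum : (l.map fun a => if popCount a = c then 1 else 0).sum =
      l.countP fun a => popCount a = c := by
    clear h hlen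
    induction l with
    | nil => rfl
    | cons a l ih => simp [List.countP_cons, ih, add_comm]
  have hpop := popCount_le
  have hxor (a : ℕ) : popCount a ^^^ (31 - c) < 2 ^ 5 :=
    Nat.xor_lt_two_pow (by have := hpop a; omega) (by omega)
  have hone (f : ℕ → ℕ) : (l.map fun _ => 1) = (l.map f).map fun _ => 1 := by
    rw [List.map_map]; rfl
  have hW := bitSum_eq l h.lt (n := 27) (by norm_num)
  change _ = Nat.ofDigits (2 ^ 32) (l.map popCount) at hW
  have hX := ofDigits_map_xor (r := 31 - c) (by omega) (l.map popCount) (by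
    intro a ha
    obtain ⟨b, -, rfl⟩ := List.mem_map.1 ha
    have := hpop b
    omega)
  rw [← hone, List.map_map] at hX
  have hY := ofDigits_map_testBit (b := 5) (by norm_num)
    (l.map fun a => (popCount a ^^^ (31 - c)) + 1) (by
      intro a ha
      obtain ⟨b, -, rfl⟩ := List.mem_map.1 ha
      have := hxor b
      omega)
  rw [← hone, List.map_map] at hY
  have hZ : ((fun a : ℕ => (a.testBit 5).toNat) ∘ fun a => (popCount a ^^^ (31 - c)) + 1) =
      fun a => if popCount a = c then 1 else 0 :=
    funext fun a => eq_test _ (hpop a) c hc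
  rw [hZ] at hY
  rw [Pack.count, h.ones, h.val, hW, hX, ofDigits_map_add]
  simp only [Function.comp_apply]
  rw [hY, ofDigits_mod_eq_sum, hsum]
  rw [hsum]
  exact lt_of_le_of_lt List.countP_le_length hlen

lemma Pack.Represents.append {p q : Pack} {l m : List ℕ} (hp : p.Represents l)
    (hq : q.Represents m) : (p.append q).Represents (l ++ m) where
  len := by simp [Pack.append, hp.len, hq.len]
  ones := by
    simp only [Pack.append]
    rw [hp.len, hp.ones, hq.ones, List.map_append, Nat.ofDigits_append,
      Nat.shiftLeft_eq, pow_mul, mul_comm, List.length_map]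
  val := by
    simp only [Pack.append]
    rw [hp.len, hp.val, hq.val, Nat.ofDigits_append, Nat.shiftLeft_eq, pow_mul, mul_comm]
  lt a ha := (List.mem_append.1 ha).elim (hp.lt a) (hq.lt a)

lemma Pack.Represents.xor {p : Pack} {l : List ℕ} (hp : p.Represents l) {r : ℕ}
    (hr : r < 2 ^ 32) : (p.xor r).Represents (l.map (· ^^^ r)) where
  len := by simp [Pack.xor, hp.len]
  ones := by simp [Pack.xor, hp.ones, Function.comp_def]
  val := by
    simp only [Pack.xor, hp.ones, hp.val]
    exact ofDigits_map_xor hr l hp.lt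
  lt a ha := by
    obtain ⟨b, hb, rfl⟩ := List.mem_map.1 ha
    exact Nat.xor_lt_two_pow (hp.lt b hb) hr

/-- The sums (bitwise exclusive or) of the `k`-element sublists of a list. -/
def sublistXors : ℕ → List ℕ → List ℕ
  | 0, _ => [0]
  | _ + 1, [] => []
  | k + 1, r :: rs => sublistXors (k + 1) rs ++ (sublistXors k rs).map (· ^^^ r)

lemma length_sublistXors (k : ℕ) (rs : List ℕ) :
    (sublistXors k rs).length = rs.length.choose k := by
  induction rs generalizing k with
  | nil => cases k <;> simp [sublistXors]
  | cons r rs ih =>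
    cases k with
    | zero => simp [sublistXors]
    | succ k => simp [sublistXors, ih, Nat.choose_succ_succ, add_comm]

/-- The packs represent the lists of sums of `j`, `j + 1`, … members of `rs`. -/
def RepresentsFrom (rs : List ℕ) : ℕ → List Pack → Prop
  | _, [] => True
  | j, p :: ps => p.Represents (sublistXors j rs) ∧ RepresentsFrom rs (j + 1) ps

/-- The number of sums of `j` members of `rs` with weight `c`. -/
def sumCount (rs : List ℕ) (j c : ℕ) : ℕ :=
  (sublistXors j rs).countP fun a => popCount a = c

lemma advance_eq {α : Type} {r : ℕ} (hr : r < 2 ^ 32) {rs : List ℕ} (hrs : rs.length < 31)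
    (ps : List Pack) {c : ℕ} (hc : c ≤ 27) {prev : Pack} {j : ℕ}
    (hprev : prev.Represents (sublistXors j rs)) (hps : RepresentsFrom rs (j + 1) ps) (acc : ℕ)
    (k : List Pack → ℕ → α) :
    ∃ ps' acc', advance r c prev ps acc k = k ps' acc' ∧ ps'.length = ps.length ∧
      RepresentsFrom (r :: rs) (j + 1) ps' ∧
      acc' + ∑ i ∈ Finset.range (ps.length + 1), sumCount rs (j + 1 + i) (c - i) =
        acc + ∑ i ∈ Finset.range (ps.length + 1), sumCount (r :: rs) (j + 1 + i) (c - i) := by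
  have hq := hprev.xor hr
  have hcount := hq.count_eq (by
    rw [List.length_map, length_sublistXors]
    refine (Nat.choose_le_two_pow _ _).trans_lt ?_
    exact (Nat.pow_le_pow_right two_pos (Nat.le_of_lt_succ hrs)).trans_lt (by norm_num)) hc
  have hcons : sumCount (r :: rs) (j + 1) c = sumCount rs (j + 1) c + (prev.xor r).count c := by
    rw [hcount, sumCount, sublistXors, List.countP_append, sumCount]
  induction ps generalizing c prev j acc k with
  | nil =>
    refine ⟨[], acc + (prev.xor r).count c, ?_, rfl, trivial, ?_⟩
    · simp [advance, Pack.force_eq, force_eq]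
    · simp [hcons]; ring
  | cons p ps ih =>
    obtain ⟨hp, hps⟩ := hps
    have hq' := hp.xor hr
    have hcount' := hq'.count_eq (c := c - 1) (by
      rw [List.length_map, length_sublistXors]
      refine (Nat.choose_le_two_pow _ _).trans_lt ?_
      exact (Nat.pow_le_pow_right two_pos (Nat.le_of_lt_succ hrs)).trans_lt (by norm_num))
      (by omega)
    obtain ⟨ps', acc', h1, h2, h3, h4⟩ := ih (c := c - 1) (by omega) hp hps
      (acc + (prev.xor r).count c) (fun ps' acc' => k (p.append (prev.xor r) :: ps') acc') hq'
      hcount' (by rw [hcount', sumCount, sublistXors, List.countP_append, sumCount])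
    refine ⟨p.append (prev.xor r) :: ps', acc', ?_, by simp [h2], ⟨?_, h3⟩, ?_⟩
    · rw [← h1]
      simp [advance, Pack.force_eq, force_eq]
    · exact hp.append hq
    · rw [List.length_cons, Finset.sum_range_succ' _ (ps.length + 1),
        Finset.sum_range_succ' _ (ps.length + 1)]
      have e (s : List ℕ) (i : ℕ) : sumCount s (j + 1 + (i + 1)) (c - (i + 1)) =
          sumCount s (j + 1 + 1 + i) (c - 1 - i) := by
        congr 1 <;> omega
      simp only [e, Nat.add_zero, Nat.sub_zero, hcons]
      omega

lemma run_eq {c : ℕ} (hc : c ≤ 27) (rs done : List ℕ) (hrs : ∀ r ∈ rs, r < 2 ^ 32)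
    (hlen : rs.length + done.length < 32) (ps : List Pack) (hps : RepresentsFrom done 1 ps)
    (acc : ℕ) :
    run c rs ps acc + ∑ i ∈ Finset.range (ps.length + 1), sumCount done (1 + i) (c - i) =
      acc + ∑ i ∈ Finset.range (ps.length + 1),
        sumCount (rs.reverse ++ done) (1 + i) (c - i) := by
  induction rs generalizing done ps acc with
  | nil => simp [run]
  | cons r rs ih =>
    simp only [List.mem_cons, forall_eq_or_imp, List.length_cons] at hrs hlen
    have h0 : (⟨1, 1, 0⟩ : Pack).Represents (sublistXors 0 done) := by
      constructor <;> simp [sublistXors]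
    obtain ⟨ps', acc', h1, h2, h3, h4⟩ := advance_eq hrs.1 (by omega) ps hc h0 hps acc
      (fun ps' acc' => run c rs ps' acc')
    have := ih (r :: done) hrs.2 (by rw [List.length_cons]; omega) ps' h3 acc'
    rw [run, h1, List.reverse_cons, List.append_assoc, List.singleton_append]
    rw [h2] at this
    simp only [Nat.zero_add] at h4
    omega

lemma total_eq (a K : ℕ) {c : ℕ} (hc : c ≤ 27) :
    total a K c = ∑ i ∈ Finset.range (K + 1),
      sumCount ((List.finRange 27).map (circRow a)) (1 + i) (c - i) := by
  have hps (j : ℕ) : RepresentsFrom [] (j + 1) (List.replicate K ⟨0, 0, 0⟩) := by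
    induction K generalizing j with
    | zero => trivial
    | succ K ih => exact ⟨by constructor <;> simp [sublistXors], ih _⟩
  have h := run_eq hc ((List.finRange 27).map (circRow a)).reverse [] (by
      intro r hr
      obtain ⟨i, -, rfl⟩ := List.mem_map.1 (List.mem_reverse.1 hr)
      exact (Nat.mod_lt _ (by norm_num)).trans (by norm_num))
    (by simp) _ (hps 0) 0
  have hz (i : ℕ) : sumCount [] (1 + i) (c - i) = 0 := by
    rw [add_comm]; simp [sumCount, sublistXors]
  rw [total]
  simpa only [hz, Finset.sum_const_zero, Nat.add_zero, Nat.zero_add, List.reverse_reverse,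
    List.append_nil, List.length_replicate] using h

/-- The bitwise exclusive or of a multiset of numbers. -/
def xorSum (s : Multiset ℕ) : ℕ := s.fold (fun a b : ℕ => a ^^^ b) 0

lemma xorSum_zero : xorSum 0 = 0 := rfl

lemma xorSum_cons (a : ℕ) (s : Multiset ℕ) : xorSum (a ::ₘ s) = a ^^^ xorSum s :=
  Multiset.fold_cons_left _ _ _ _

lemma coe_sublistXors {ι : Type*} (f : ι → ℕ) (k : ℕ) (l : List ι) :
    (sublistXors k (l.map f) : Multiset ℕ) =
      (Multiset.powersetCard k (l : Multiset ι)).map fun s => xorSum (s.map f) := by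
  induction l generalizing k with
  | nil => cases k <;> simp [sublistXors, Multiset.powersetCard_zero_right, xorSum_zero]
  | cons i l ih =>
    cases k with
    | zero => simp [sublistXors, xorSum_zero]
    | succ k =>
      rw [← Multiset.cons_coe, Multiset.powersetCard_cons, Multiset.map_add, List.map_cons,
        sublistXors, ← Multiset.coe_add, ← Multiset.map_coe, ih (k + 1), ih k, Multiset.map_map,
        Multiset.map_map]
      simp [Nat.xor_comm, xorSum_cons]

lemma sumCount_eq_card {n : ℕ} (f : Fin n → ℕ) (k c : ℕ) :
    sumCount ((List.finRange n).map f) k c =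
      ((Finset.powersetCard k Finset.univ).filter fun s : Finset (Fin n) =>
        popCount (xorSum (s.val.map f)) = c).card := by
  have huniv : ((List.finRange n : List (Fin n)) : Multiset (Fin n)) = Finset.univ.val := rfl
  rw [sumCount, ← Multiset.coe_countP, coe_sublistXors, huniv, ← Finset.map_val_val_powersetCard,
    Multiset.map_map, Multiset.countP_map]
  simp only [Function.comp_apply]
  rfl

/-- The circulant matrix whose first row consists of the binary digits of `a`. -/
def circMat (a : ℕ) : Matrix (Fin 27) (Fin 27) (ZMod 2) :=
  Matrix.of fun i j => if (circRow a i).testBit j then 1 else 0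

lemma testBit_fold_xor {ι : Type*} (f : ι → ℕ) (s : Multiset ι) (b : ℕ) :
    (if (xorSum (s.map f)).testBit b then (1 : ZMod 2) else 0) =
      (s.map fun i => if (f i).testBit b then (1 : ZMod 2) else 0).sum := by
  induction s using Multiset.induction with
  | empty => simp [xorSum_zero]
  | cons i s ih =>
    rw [Multiset.map_cons, xorSum_cons, Multiset.map_cons, Multiset.sum_cons, ← ih,
      Nat.testBit_xor]
    cases (f i).testBit b <;> cases (xorSum (s.map f)).testBit b <;> decide

lemma vecMul_circMat (a : ℕ) (x : Fin 27 → ZMod 2) (b : Fin 27) :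
    (Matrix.vecMul x (circMat a)) b =
      if (xorSum ((Finset.univ.filter fun i => x i ≠ 0).val.map (circRow a))).testBit b
        then 1 else 0 := by
  rw [testBit_fold_xor]
  change ∑ i, x i * circMat a i b = ∑ i ∈ Finset.univ.filter fun i => x i ≠ 0, circMat a i b
  rw [Finset.sum_filter]
  refine Finset.sum_congr rfl fun i _ => ?_
  generalize circMat a i b = v
  generalize x i = u
  revert u v
  decide

lemma wt_vecMul_circMat (a : ℕ) (x : Fin 27 → ZMod 2) :
    wt (Matrix.vecMul x (circMat a)) =
      popCount (xorSum ((Finset.univ.filter fun i => x i ≠ 0).val.map (circRow a))) := by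
  rw [wt, popCount, Finset.card_filter, Finset.sum_range]
  refine Finset.sum_congr rfl fun b _ => ?_
  rw [vecMul_circMat]
  cases Nat.testBit _ _ <;> simp

lemma card_wt_eq (a k c : ℕ) :
    (Finset.univ.filter fun x : Fin 27 → ZMod 2 =>
      wt x = k ∧ wt (Matrix.vecMul x (circMat a)) = c).card =
      sumCount ((List.finRange 27).map (circRow a)) k c := by
  rw [sumCount_eq_card]
  refine Finset.card_nbij' (fun x => Finset.univ.filter fun i => x i ≠ 0)
    (fun s i => if i ∈ s then 1 else 0) ?_ ?_ ?_ ?_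
  · intro x hx
    simp only [Finset.coe_filter, Finset.mem_univ, true_and, Set.mem_ofPred_eq,
      Finset.mem_powersetCard, Finset.subset_univ] at hx ⊢
    rwa [← wt_vecMul_circMat]
  · intro s hs
    have h : (Finset.univ.filter fun i => (if i ∈ s then (1 : ZMod 2) else 0) ≠ 0) = s := by
      ext i; simp
    simp only [Finset.coe_filter, Finset.mem_univ, true_and, Set.mem_ofPred_eq,
      Finset.mem_powersetCard, Finset.subset_univ] at hs ⊢
    rw [wt_vecMul_circMat, wt, h]
    exact hs
  · intro x _
    have h : ∀ u : ZMod 2, (if u ≠ 0 then 1 else 0) = u := by decide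
    funext i
    simpa using h (x i)
  · intro s _
    ext i; simp

lemma wt_eq_zero {ι : Type*} [Fintype ι] {x : ι → ZMod 2} : wt x = 0 ↔ x = 0 := by
  simp [wt, Finset.filter_eq_empty_iff, funext_iff]

lemma card_wt_le (a : ℕ) {K w : ℕ} (hK : K < w) (hw : w ≤ 28) :
    (Finset.univ.filter fun x : Fin 27 → ZMod 2 =>
      wt x ≤ K + 1 ∧ wt x + wt (Matrix.vecMul x (circMat a)) = w).card = total a K (w - 1) := by
  rw [total_eq a K (by omega),
    Finset.card_eq_sum_card_fiberwise (f := fun x => wt x - 1) (t := Finset.range (K + 1))]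
  · refine Finset.sum_congr rfl fun i hi => ?_
    rw [← card_wt_eq, Finset.filter_filter]
    refine congrArg Finset.card (Finset.ext fun x => ?_)
    have hi := Finset.mem_range.1 hi
    have h0 : wt x = 0 → wt (Matrix.vecMul x (circMat a)) = 0 := by
      simp only [wt_eq_zero]
      rintro rfl
      exact Matrix.zero_vecMul _
    simp only [Finset.mem_filter, Finset.mem_univ, true_and]
    omega
  · intro x hx
    simp only [Finset.coe_filter, Finset.mem_univ, true_and, Set.mem_ofPred_eq, Finset.coe_range,
      Set.mem_Iio] at hx ⊢
    omega

section genMat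

variable {n : ℕ} (M : Matrix (Fin n) (Fin n) (ZMod 2))

lemma vecMul_genMat (x : Fin n → ZMod 2) :
    Matrix.vecMul x (genMat M) = Sum.elim x (Matrix.vecMul x M) := by
  funext j
  cases j with
  | inl j => simp [Matrix.vecMul, dotProduct, genMat]
  | inr j => simp [Matrix.vecMul, dotProduct, genMat]

lemma rowSpan_genMat : rowSpan (genMat M) = LinearMap.range (genMat M).vecMulLinear :=
  (range_vecMulLinear _).symm

lemma mem_rowSpan_genMat {c : Fin n ⊕ Fin n → ZMod 2} :
    c ∈ rowSpan (genMat M) ↔ ∃ x, Sum.elim x (Matrix.vecMul x M) = c := by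
  simp [rowSpan_genMat, LinearMap.mem_range, vecMul_genMat]

lemma finrank_rowSpan_genMat : Module.finrank (ZMod 2) (rowSpan (genMat M)) = n := by
  rw [rowSpan_genMat, LinearMap.finrank_range_of_inj, Module.finrank_fin_fun]
  intro x y h
  simp only [Matrix.vecMulLinear_apply, vecMul_genMat] at h
  exact congrArg (· ∘ Sum.inl) h

lemma wt_sumElim (x y : Fin n → ZMod 2) : wt (Sum.elim x y) = wt x + wt y := by
  simp only [wt, Finset.card_filter, Fintype.sum_sum_type, Sum.elim_inl, Sum.elim_inr]
  rfl

lemma Awt_genMat (w : ℕ) : Awt (rowSpan (genMat M)) w =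
    (Finset.univ.filter fun x => wt x + wt (Matrix.vecMul x M) = w).card := by
  have h : {c ∈ (rowSpan (genMat M) : Set (Fin n ⊕ Fin n → ZMod 2)) | wt c = w} =
      (fun x => Sum.elim x (Matrix.vecMul x M)) ''
        {x | wt x + wt (Matrix.vecMul x M) = w} := by
    ext c
    simp only [Set.mem_ofPred_eq, SetLike.mem_coe, mem_rowSpan_genMat, Set.mem_image]
    constructor
    · rintro ⟨⟨x, rfl⟩, h⟩
      exact ⟨x, by rwa [← wt_sumElim], rfl⟩
    · rintro ⟨x, h, rfl⟩
      exact ⟨⟨x, rfl⟩, by rwa [wt_sumElim]⟩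
  rw [Awt, h, Set.ncard_image_of_injective, ← Set.ncard_coe_finset]
  · simp
  · intro x y hxy
    exact congrArg (· ∘ Sum.inl) hxy

lemma natCast_wt {ι : Type*} [Fintype ι] (x : ι → ZMod 2) : (wt x : ZMod 2) = ∑ i, x i := by
  have h : ∀ u : ZMod 2, (if u ≠ 0 then 1 else 0) = u := by decide
  rw [wt, Finset.card_filter]
  push_cast
  exact Finset.sum_congr rfl fun i _ => h (x i)

lemma isEvenCode_rowSpan {ι κ : Type*} [Fintype κ] {M : Matrix ι κ (ZMod 2)}
    (h : ∀ i, ∑ j, M i j = 0) : IsEvenCode (rowSpan M) := by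
  intro c hc
  rw [← ZMod.natCast_eq_zero_iff, natCast_wt]
  induction hc using Submodule.span_induction with
  | mem x hx => obtain ⟨i, rfl⟩ := hx; exact h i
  | zero => simp
  | add x y _ _ hx hy => simp [Finset.sum_add_distrib, hx, hy]
  | smul r x _ hx => simp [← Finset.mul_sum, hx]

lemma not_isSelfDual_rowSpan {ι κ : Type*} [Fintype κ] {M : Matrix ι κ (ZMod 2)} {i j : ι}
    (h : ∑ l, M i l * M j l ≠ 0) : ¬ IsSelfDual (rowSpan M) := by
  intro hC
  have hi : M i ∈ rowSpan M := Submodule.subset_span ⟨i, rfl⟩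
  have hj : M j ∈ rowSpan M := Submodule.subset_span ⟨j, rfl⟩
  rw [hC] at hi
  exact h (hi _ hj)

end genMat

/-- If `A` is invertible with inverse `B`, each vector `(x, x A)` of weight `k + l + 1` has either
weight at most `k` on the left half or weight at most `l` on the right half. -/
lemma card_wt_add_wt_vecMul {n k l w : ℕ} {A B : Matrix (Fin n) (Fin n) (ZMod 2)}
    (hAB : A * B = 1) (hBA : B * A = 1) (hw : w = k + l + 1) :
    (Finset.univ.filter fun x => wt x + wt (Matrix.vecMul x A) = w).card =
      (Finset.univ.filter fun x => wt x ≤ k ∧ wt x + wt (Matrix.vecMul x A) = w).card +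
      (Finset.univ.filter fun x => wt x ≤ l ∧ wt x + wt (Matrix.vecMul x B) = w).card := by
  rw [← Finset.card_filter_add_card_filter_not (fun x => wt x ≤ k), Finset.filter_filter,
    Finset.filter_filter]
  congr 1
  · simp only [and_comm]
  · refine Finset.card_nbij' (fun x => Matrix.vecMul x A) (fun x => Matrix.vecMul x B) ?_ ?_ ?_ ?_
    · intro x hx
      simp only [Finset.coe_filter, Finset.mem_univ, true_and, Set.mem_ofPred_eq,
        Matrix.vecMul_vecMul, hAB, Matrix.vecMul_one] at hx ⊢
      omega
    · intro x hx
      simp only [Finset.coe_filter, Finset.mem_univ, true_and, Set.mem_ofPred_eq,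
        Matrix.vecMul_vecMul, hBA, Matrix.vecMul_one] at hx ⊢
      omega
    · intro x _
      simp [Matrix.vecMul_vecMul, hAB]
    · intro x _
      simp [Matrix.vecMul_vecMul, hBA]

lemma Awt_genMat_circMat {a b : ℕ} (hab : circMat a * circMat b = 1)
    (hba : circMat b * circMat a = 1) {K : ℕ} (hK : K ≤ 12) :
    Awt (rowSpan (genMat (circMat a))) (2 * (K + 2)) =
      total a (K + 1) (2 * (K + 2) - 1) + total b K (2 * (K + 2) - 1) := by
  rw [Awt_genMat, card_wt_add_wt_vecMul hab hba (k := K + 2) (l := K + 1) (by omega),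
    card_wt_le a (K := K + 1) (by omega) (by omega), card_wt_le b (by omega) (by omega)]

lemma Awt_two_genMat_circMat (a : ℕ) :
    Awt (rowSpan (genMat (circMat a))) 2 = total a 1 1 := by
  rw [Awt_genMat, ← card_wt_le a (K := 1) (w := 2) (by omega) (by omega)]
  refine congrArg Finset.card (Finset.filter_congr fun x _ => ?_)
  omega

lemma circMat_mul_circMat : circMat 105307143 * circMat 77902026 = 1 := by
  decide +kernel

lemma circMat_mul_circMat_symm : circMat 77902026 * circMat 105307143 = 1 := by
  decide +kernel

/-- The numbers of codewords of weights 4, 6, 8, 10, 12 and 14. -/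
lemma total_add_total : ((List.range 6).map fun K =>
    total 105307143 (K + 1) (2 * (K + 2) - 1) + total 77902026 K (2 * (K + 2) - 1)) =
      [0, 0, 0, 27, 6030, 49545] := by
  decide +kernel

lemma total_one_one : total 105307143 1 1 = 0 := by
  decide +kernel

lemma eq_circMat {R : Matrix (Fin 27) (Fin 27) (ZMod 2)} (hR : IsCirculant R)
    (h0 : R 0 = ![1, 1, 1, 0, 0, 0, 0, 0, 0, 0, 1, 1, 1, 0, 1, 1, 0, 1, 1, 0, 0, 0, 1, 0,
      0, 1, 1]) : R = circMat 105307143 := by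
  have h1 : R 0 = fun j : Fin 27 => if Nat.testBit 105307143 j then 1 else 0 := by
    rw [h0]
    decide +kernel
  have h2 : ∀ i j : Fin 27, Nat.testBit 105307143 ((j - i : Fin 27) : ℕ) =
      (circRow 105307143 i).testBit j := by
    decide +kernel
  ext i j
  have h := hR 0 (j - i) i
  rw [zero_add, sub_add_cancel, h1] at h
  rw [h, circMat, Matrix.of_apply, ← h2]

/-- The pure double circulant code `P_{54}`. -/
theorem stmt_16 (R : Matrix (Fin 27) (Fin 27) (ZMod 2)) (hR : IsCirculant R)
    (h0 : R 0 = ![1, 1, 1, 0, 0, 0, 0, 0, 0, 0, 1, 1, 1, 0, 1, 1, 0, 1, 1, 0, 0, 0, 1, 0,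
      0, 1, 1]) :
    IsEvenCode (rowSpan (genMat R)) ∧
    Module.finrank (ZMod 2) (rowSpan (genMat R)) = 27 ∧
    HasMinWt (rowSpan (genMat R)) 10 ∧
    ¬ IsSelfDual (rowSpan (genMat R)) ∧
    Awt (rowSpan (genMat R)) 10 = 27 ∧
    Awt (rowSpan (genMat R)) 12 = 6030 ∧
    Awt (rowSpan (genMat R)) 14 = 49545 := by
  obtain rfl := eq_circMat hR h0
  have hA (K : ℕ) (hK : K ≤ 12) := Awt_genMat_circMat circMat_mul_circMat circMat_mul_circMat_symm hK
  have hT := total_add_total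
  simp only [List.range, List.range.loop, List.map_cons, List.map_nil, List.cons.injEq] at hT
  obtain ⟨h4, h6, h8, h10, h12, h14, -⟩ := hT
  rw [← hA _ (by norm_num)] at h4 h6 h8 h10 h12 h14
  norm_num at h4 h6 h8 h10 h12 h14
  have heven : IsEvenCode (rowSpan (genMat (circMat 105307143))) :=
    isEvenCode_rowSpan (by decide +kernel)
  refine ⟨heven, finrank_rowSpan_genMat _, ⟨?_, ?_⟩,
    not_isSelfDual_rowSpan (i := 0) (j := 3) (by decide +kernel), h10, h12, h14⟩
  · have h : Awt (rowSpan (genMat (circMat 105307143))) 10 ≠ 0 := by omega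
    obtain ⟨c, hc, hwt⟩ := Set.nonempty_of_ncard_ne_zero h
    refine ⟨c, hc, ?_, hwt⟩
    rintro rfl
    rw [wt_eq_zero.2 rfl] at hwt
    omega
  · intro c hc hc0
    have hne : wt c ≠ 0 := fun h => hc0 (wt_eq_zero.1 h)
    have hA0 : Awt (rowSpan (genMat (circMat 105307143))) (wt c) ≠ 0 :=
      Set.ncard_ne_zero_of_mem ⟨hc, rfl⟩
    obtain ⟨m, hm⟩ := heven c hc
    by_contra! hlt
    have hm4 : m = 1 ∨ m = 2 ∨ m = 3 ∨ m = 4 := by omega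
    rcases hm4 with rfl | rfl | rfl | rfl <;> rw [hm] at hA0
    · exact hA0 ((Awt_two_genMat_circMat _).trans total_one_one)
    · exact hA0 h4
    · exact hA0 h6
    · exact hA0 h8
end
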